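/- Let d ≥ 1 and let H be a set of Lipschitz maps from ℝ^d to ℝ^d that is a sup-universal approximator for the set Lip(ℝ^d) of all Lipschitz maps from ℝ^d to ℝ^d. Then the set Ψ(H) := { φ_f(·,1) : f ∈ H } of time-1 flow maps of elements of H is a sup-universal approximator for the set Ψ(Lip(ℝ^d)) := { φ_F(·,1) : F ∈ Lip(ℝ^d) } of time-1 flow maps of all Lipschitz vector fields on ℝ^d. -/

import Mathlib

noncomputable section

abbrev Euc (d : ℕ) := EuclideanSpace ℝ (Fin d)

/-- `φ` is the global flow of the vector field `f`. -/
def IsFlow {E : Type*} [NormedAddCommGroup E] [NormedSpace ℝ E]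
    (f : E → E) (φ : E → ℝ → E) : Prop :=
  ∀ x, φ x 0 = x ∧ ∀ t : ℝ, HasDerivAt (φ x) (f (φ x t)) t

open Set Filter Topology Metric

/-- Clamping every coordinate to `[-R, R]`. -/
def boxClamp {d : ℕ} (R : ℝ) (y : Euc d) : Euc d :=
  WithLp.toLp 2 fun i => max (-R) (min R (y i))

lemma lipschitzWith_boxClamp (d : ℕ) (R : ℝ) :
    ∃ C : NNReal, LipschitzWith C (boxClamp R : Euc d → Euc d) := by
  have h : LipschitzWith 1 fun (w : Fin d → ℝ) (i : Fin d) => max (-R) (min R (w i)) :=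
    LipschitzWith.of_dist_le_mul fun u w => by
      rw [NNReal.coe_one, one_mul, dist_pi_le_iff dist_nonneg]
      refine fun i => le_trans ?_ (dist_le_pi_dist u w i)
      simpa using ((LipschitzWith.id.const_min R).const_max (-R)).dist_le_mul (u i) (w i)
  exact ⟨_, ((PiLp.lipschitzWith_toLp 2 fun _ : Fin d => ℝ).comp h).comp
    (PiLp.lipschitzWith_ofLp 2 fun _ : Fin d => ℝ)⟩

lemma norm_boxClamp_le {d : ℕ} {R : ℝ} (hR : 0 ≤ R) (y : Euc d) : ‖boxClamp R y‖ ≤ ‖y‖ := by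
  rw [EuclideanSpace.norm_eq, EuclideanSpace.norm_eq]
  refine Real.sqrt_le_sqrt (Finset.sum_le_sum fun i _ => ?_)
  simp only [boxClamp, Real.norm_eq_abs]
  exact pow_le_pow_left₀ (abs_nonneg _) (by grind) 2

lemma exists_norm_boxClamp_le (d : ℕ) (R : ℝ) :
    ∃ B : ℝ, ∀ y : Euc d, ‖boxClamp R y‖ ≤ B := by
  refine ⟨√(∑ _i : Fin d, R ^ 2), fun y => ?_⟩
  rw [EuclideanSpace.norm_eq]
  refine Real.sqrt_le_sqrt (Finset.sum_le_sum fun i _ => ?_)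
  simp only [boxClamp, Real.norm_eq_abs]
  exact sq_le_sq.2 (by grind)

lemma boxClamp_eq_self {d : ℕ} {R : ℝ} {y : Euc d} (hy : ‖y‖ ≤ R) : boxClamp R y = y := by
  ext i
  have := (PiLp.norm_apply_le y i).trans hy
  rw [Real.norm_eq_abs, abs_le] at this
  simp only [boxClamp]
  rw [min_eq_right this.2, max_eq_right this.1]

lemma LipschitzWith.norm_le_add {E : Type*} [NormedAddCommGroup E] {C : NNReal} {f : E → E}
    (hf : LipschitzWith C f) (y : E) : ‖f y‖ ≤ C * ‖y‖ + ‖f 0‖ := by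
  have h := hf.dist_le_mul y 0
  rw [dist_eq_norm, dist_zero_right] at h
  linarith [norm_le_norm_add_norm_sub' (f y) (f 0)]

section Banach

variable {E : Type*} [NormedAddCommGroup E] [NormedSpace ℝ E]

/-- A bounded Lipschitz vector field has solutions on every symmetric interval. -/
lemma exists_hasDerivWithinAt_Icc_of_bounded [CompleteSpace E] {C L : NNReal} {f : E → E}
    (hf : LipschitzWith C f) (hL : ∀ y, ‖f y‖ ≤ L) (x : E) (T : NNReal) :
    ∃ α : ℝ → E, α 0 = x ∧
      ∀ t ∈ Icc (-T : ℝ) T, HasDerivWithinAt α (f (α t)) (Icc (-T : ℝ) T) t := by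
  have hpl : IsPicardLindelof (fun _ => f) (tmin := -T) (tmax := T)
      ⟨0, by simp, by simp⟩ x (L * T) 0 L C :=
    { lipschitzOnWith := fun _ _ => hf.lipschitzOnWith
      continuousOn := fun _ _ => continuousOn_const
      norm_le := fun _ _ y _ => hL y
      mul_max_le := by simp }
  exact hpl.exists_eq_forall_mem_Icc_hasDerivWithinAt₀

lemma norm_le_gronwallBound_of_linear_growth_right {f : E → E} {k c T : ℝ}
    (hf : ∀ y, ‖f y‖ ≤ k * ‖y‖ + c) {α : ℝ → E}
    (hα : ∀ t ∈ Icc 0 T, HasDerivWithinAt α (f (α t)) (Icc 0 T) t) {t : ℝ} (ht : t ∈ Icc 0 T) :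
    ‖α t‖ ≤ gronwallBound ‖α 0‖ k c t := by
  have := norm_le_gronwallBound_of_norm_deriv_right_le (f' := fun t => f (α t))
    (fun s hs => (hα s hs).continuousWithinAt)
    (fun s hs => (hα s (Ico_subset_Icc_self hs)).mono_of_mem_nhdsWithin
      (Icc_mem_nhdsGE_of_mem hs)) le_rfl (fun s _ => hf (α s)) t ht
  simpa using this

lemma norm_le_gronwallBound_of_linear_growth {f : E → E} {k c T : ℝ} (hk : 0 ≤ k) (hc : 0 ≤ c)
    (hf : ∀ y, ‖f y‖ ≤ k * ‖y‖ + c) {α : ℝ → E}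
    (hα : ∀ t ∈ Icc (-T) T, HasDerivWithinAt α (f (α t)) (Icc (-T) T) t)
    {t : ℝ} (ht : t ∈ Icc (-T) T) :
    ‖α t‖ ≤ gronwallBound ‖α 0‖ k c T := by
  have hT : 0 ≤ T := by linarith [ht.1, ht.2]
  rcases le_total 0 t with h0 | h0
  · refine (norm_le_gronwallBound_of_linear_growth_right (T := T) hf (fun s hs => ?_)
      ⟨h0, ht.2⟩).trans (gronwallBound_mono (norm_nonneg _) hc hk ht.2)
    have hsub : Icc 0 T ⊆ Icc (-T) T := Icc_subset_Icc_left (by linarith)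
    exact (hα s (hsub hs)).mono hsub
  · have hβ : ∀ s ∈ Icc 0 T, HasDerivWithinAt (fun s => α (-s)) (-f (α (-s))) (Icc 0 T) s := by
      intro s hs
      have hmaps : MapsTo (fun s : ℝ => -s) (Icc 0 T) (Icc (-T) T) :=
        fun u hu => ⟨by linarith [hu.2], by linarith [hu.1]⟩
      simpa [Function.comp_def] using
        (hα (-s) (hmaps hs)).scomp s (hasDerivAt_neg s).hasDerivWithinAt hmaps
    have := norm_le_gronwallBound_of_linear_growth_right (f := fun y => -f y) (t := -t)
      (fun y => by simpa using hf y) hβ ⟨by linarith, by linarith [ht.1]⟩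
    simp only [neg_neg, neg_zero] at this
    exact this.trans (gronwallBound_mono (norm_nonneg _) hc hk (by linarith [ht.1]))

/-- Solutions on arbitrarily long symmetric intervals glue to a global flow. -/
lemma exists_isFlow_of_forall_Ioo {C : NNReal} {f : E → E} (hf : LipschitzWith C f)
    (h : ∀ (x : E) (T : ℝ), 0 < T → ∃ α : ℝ → E, α 0 = x ∧
      ∀ t ∈ Ioo (-T) T, HasDerivAt α (f (α t)) t) :
    ∃ φ, IsFlow f φ := by
  choose! α hα0 hα using h
  refine ⟨fun x t => α x (|t| + 1) t, fun x => ⟨hα0 x _ (by positivity), fun t => ?_⟩⟩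
  have ht : t ∈ Ioo (-(|t| + 1)) (|t| + 1) := abs_lt.mp (lt_add_one _)
  refine (hα x _ (by positivity) t ht).congr_of_eventuallyEq ?_
  filter_upwards [Ioo_mem_nhds ht.1 ht.2] with s hs
  have hs' : s ∈ Ioo (-(|s| + 1)) (|s| + 1) := abs_lt.mp (lt_add_one _)
  have hmin : ∀ u, u ∈ Ioo (-(min (|s| + 1) (|t| + 1))) (min (|s| + 1) (|t| + 1)) ↔
      u ∈ Ioo (-(|s| + 1)) (|s| + 1) ∧ u ∈ Ioo (-(|t| + 1)) (|t| + 1) := by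
    intro u
    rw [mem_Ioo, mem_Ioo, mem_Ioo, ← abs_lt, ← abs_lt, ← abs_lt, lt_min_iff]
  refine ODE_solution_unique_of_mem_Ioo (v := fun _ => f) (s := fun _ => univ) (t₀ := 0)
    (fun _ _ => hf.lipschitzOnWith) ?_ (fun u hu => ⟨hα x _ (by positivity) u ?_, trivial⟩)
    (fun u hu => ⟨hα x _ (by positivity) u ?_, trivial⟩) ?_ ((hmin s).2 ⟨hs', hs⟩)
  · have : 0 < min (|s| + 1) (|t| + 1) := by positivity
    exact ⟨by linarith, this⟩
  · exact ((hmin u).1 hu).1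
  · exact ((hmin u).1 hu).2
  · rw [hα0 x _ (by positivity), hα0 x _ (by positivity)]

end Banach

/-- A Lipschitz vector field on `ℝ^d` has a global flow. -/
lemma LipschitzWith.exists_isFlow {d : ℕ} {C : NNReal} {f : Euc d → Euc d}
    (hf : LipschitzWith C f) : ∃ φ, IsFlow f φ := by
  refine exists_isFlow_of_forall_Ioo hf fun x T hT => ?_
  lift T to NNReal using hT.le
  have hR : 0 ≤ gronwallBound ‖x‖ C ‖f 0‖ T :=
    (norm_nonneg x).trans <| (gronwallBound_x0 ‖x‖ C ‖f 0‖).symm.le.trans <|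
      gronwallBound_mono (norm_nonneg x) (norm_nonneg _) C.coe_nonneg hT.le
  obtain ⟨P, hP⟩ := lipschitzWith_boxClamp d (gronwallBound ‖x‖ C ‖f 0‖ T)
  obtain ⟨B, hB⟩ := exists_norm_boxClamp_le d (gronwallBound ‖x‖ C ‖f 0‖ T)
  have hgrow : ∀ y, ‖f (boxClamp (gronwallBound ‖x‖ C ‖f 0‖ T) y)‖ ≤ C * ‖y‖ + ‖f 0‖ :=
    fun y => (hf.norm_le_add _).trans (by gcongr; exact norm_boxClamp_le hR y)
  have hL : ∀ y, ‖f (boxClamp (gronwallBound ‖x‖ C ‖f 0‖ T) y)‖ ≤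
      (C * B.toNNReal + ‖f 0‖₊ : NNReal) := fun y => by
    refine (hf.norm_le_add _).trans ?_
    push_cast
    gcongr
    exact (hB y).trans (Real.le_coe_toNNReal B)
  obtain ⟨α, hα0, hα⟩ := exists_hasDerivWithinAt_Icc_of_bounded (hf.comp hP) hL x T
  refine ⟨α, hα0, fun t ht => ?_⟩
  have hbound := norm_le_gronwallBound_of_linear_growth C.coe_nonneg (norm_nonneg _) hgrow hα
    (Ioo_subset_Icc_self ht)
  rw [hα0] at hbound
  have := (hα t (Ioo_subset_Icc_self ht)).hasDerivAt (Icc_mem_nhds ht.1 ht.2)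
  rwa [Function.comp_apply, boxClamp_eq_self hbound] at this

/-- if `H ⊆ Lip(ℝ^d)` is a sup-universal approximator for `Lip(ℝ^d)`,
then the set `Ψ(H)` of time-1 flow maps of elements of `H` is a sup-universal approximator
for the set `Ψ(Lip(ℝ^d))` of time-1 flow maps of all Lipschitz vector fields on `ℝ^d`. -/
theorem flow_endpoints_sup_universal_for_Lipschitz_flow_endpoints
    (d : ℕ) (hd : 1 ≤ d) (H : Set (Euc d → Euc d))
    (hH : ∀ f ∈ H, ∃ C : NNReal, LipschitzWith C f)
    (huniv : ∀ F : Euc d → Euc d, (∃ C : NNReal, LipschitzWith C F) →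
      ∀ K : Set (Euc d), IsCompact K → ∀ ε : ℝ, 0 < ε →
        ∃ g ∈ H, ∀ x ∈ K, ‖F x - g x‖ < ε)
    (F : Euc d → Euc d) (hF : ∃ C : NNReal, LipschitzWith C F)
    (ΦF : Euc d → ℝ → Euc d) (hΦF : IsFlow F ΦF)
    (K : Set (Euc d)) (hK : IsCompact K) (ε : ℝ) (hε : 0 < ε) :
    ∃ f ∈ H, ∃ φ : Euc d → ℝ → Euc d, IsFlow f φ ∧
      ∀ x ∈ K, ‖ΦF x 1 - φ x 1‖ < ε := by
  obtain ⟨C, hC⟩ := hF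
  obtain ⟨r, hr⟩ := hK.isBounded.exists_norm_le
  set R : ℝ := gronwallBound (max r 0) C ‖F 0‖ 1
  have hFbound : ∀ x ∈ K, ∀ t ∈ Icc (0 : ℝ) 1, ‖ΦF x t‖ ≤ R := by
    intro x hx t ht
    have := norm_le_gronwallBound_of_norm_deriv_right_le (f' := fun t => F (ΦF x t))
      (fun s _ => ((hΦF x).2 s).continuousAt.continuousWithinAt)
      (fun s _ => ((hΦF x).2 s).hasDerivWithinAt)
      (δ := max r 0) (by rw [(hΦF x).1]; exact (hr x hx).trans (le_max_left r 0))
      (fun s _ => hC.norm_le_add _) t ht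
    refine this.trans (gronwallBound_mono (le_max_right r 0) (norm_nonneg _) C.coe_nonneg ?_)
    simpa using ht.2
  obtain ⟨P, hP⟩ := lipschitzWith_boxClamp d (R + 1)
  obtain ⟨B, hB⟩ := exists_norm_boxClamp_le d (R + 1)
  obtain ⟨δ, hδ, hδε⟩ : ∃ δ > 0, gronwallBound 0 (C * P : NNReal) δ 1 < min ε 1 := by
    refine Eventually.exists_gt <|
      (gronwallBound_continuous_ε 0 (C * P : NNReal) 1).continuousAt.eventually_lt_const ?_
    simp only [gronwallBound_ε0_δ0]
    exact lt_min hε one_pos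
  obtain ⟨f, hfH, hfF⟩ := huniv F ⟨C, hC⟩ (closedBall 0 B) (isCompact_closedBall 0 B) δ hδ
  obtain ⟨D, hD⟩ := hH f hfH
  obtain ⟨φ, hφ⟩ := hD.exists_isFlow
  refine ⟨f, hfH, φ, hφ, fun x hx => ?_⟩
  obtain ⟨ψ, hψ⟩ := (hD.comp hP).exists_isFlow
  have hclose : ∀ t ∈ Icc (0 : ℝ) 1, dist (ΦF x t) (ψ x t) < min ε 1 := by
    intro t ht
    have := dist_le_of_approx_trajectories_ODE (v := fun _ => F ∘ boxClamp (R + 1))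
      (f' := fun t => F (ΦF x t)) (g' := fun t => f (boxClamp (R + 1) (ψ x t)))
      (εf := 0) (εg := δ) (δ := 0) (fun _ => hC.comp hP)
      (fun s _ => ((hΦF x).2 s).continuousAt.continuousWithinAt)
      (fun s _ => ((hΦF x).2 s).hasDerivWithinAt)
      (fun s hs => by
        rw [Function.comp_apply, boxClamp_eq_self, dist_self]
        linarith [hFbound x hx s (Ico_subset_Icc_self hs)])
      (fun s _ => ((hψ x).2 s).continuousAt.continuousWithinAt)
      (fun s _ => ((hψ x).2 s).hasDerivWithinAt)
      (fun s _ => by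
        rw [dist_comm, dist_eq_norm]
        exact (hfF _ (by simpa using hB (ψ x s))).le)
      (by rw [(hΦF x).1, (hψ x).1, dist_self]) t ht
    refine (this.trans (gronwallBound_mono le_rfl (by linarith) (NNReal.coe_nonneg _)
      (b := 1) (by simpa using ht.2))).trans_lt ?_
    rwa [zero_add]
  have hψf : ∀ t ∈ Icc (0 : ℝ) 1, HasDerivAt (ψ x) (f (ψ x t)) t := by
    intro t ht
    have h := (hψ x).2 t
    rwa [Function.comp_apply, boxClamp_eq_self] at h
    have h1 := (hclose t ht).trans_le (min_le_right ε 1)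
    rw [dist_eq_norm, norm_sub_rev] at h1
    linarith [norm_le_norm_add_norm_sub' (ψ x t) (ΦF x t), hFbound x hx t ht]
  have heq : ψ x 1 = φ x 1 :=
    ODE_solution_unique (v := fun _ => f) (fun _ => hD)
      (fun s _ => ((hψ x).2 s).continuousAt.continuousWithinAt)
      (fun s hs => (hψf s (Ico_subset_Icc_self hs)).hasDerivWithinAt)
      (fun s _ => ((hφ x).2 s).continuousAt.continuousWithinAt)
      (fun s _ => ((hφ x).2 s).hasDerivWithinAt)
      (by rw [(hψ x).1, (hφ x).1]) (right_mem_Icc.2 zero_le_one)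
  rw [← heq, ← dist_eq_norm]
  exact (hclose 1 (right_mem_Icc.2 zero_le_one)).trans_le (min_le_left ε 1)
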